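/- The system L_21(7^{×6},6^{×4},1) is non-special; since its virtual dimension equals −1, this means dim L_21(7^{×6},6^{×4},1) = −1, i.e., there exist points p_1,…,p_{11} ∈ K² such that the only polynomial f ∈ K[X,Y] of total degree ≤ 21 having multiplicity ≥ 7 at p_1,…,p_6, multiplicity ≥ 6 at p_7,…,p_{10} and vanishing at p_{11} is f = 0. -/

import Mathlib

open MvPolynomial

/-- The differential operator `∂^{β₁}_X ∂^{β₂}_Y` on `K[X,Y]` (with `X` the variable `0`
and `Y` the variable `1`). -/
noncomputable def derivOp (K : Type*) [CommRing K] (β : ℕ × ℕ) :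
    Module.End K (MvPolynomial (Fin 2) K) :=
  ((pderiv (0 : Fin 2)).toLinearMap ^ β.1) * ((pderiv (1 : Fin 2)).toLinearMap ^ β.2)

/-- Evaluation of a polynomial in `K[X,Y]` at a point of `K²`, as a linear map. -/
noncomputable def evalPt (K : Type*) [CommRing K] (p : K × K) :
    MvPolynomial (Fin 2) K →ₗ[K] K :=
  (MvPolynomial.aeval (fun i : Fin 2 => if i = 0 then p.1 else p.2)).toLinearMap

/-- The space of polynomials whose monomial support is contained in the diagram `D`. -/
noncomputable def monoSpan (K : Type*) [Field K] (D : Finset (ℕ × ℕ)) :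
    Submodule K (MvPolynomial (Fin 2) K) :=
  Submodule.span K ((fun d : ℕ × ℕ =>
    (monomial (Finsupp.single (0 : Fin 2) d.1 + Finsupp.single 1 d.2) (1 : K))) '' D)

/-- `L_D(m₁p₁, …, m_rp_r)`: the space of polynomials supported on `D` whose partial
derivatives of total order `< m j` all vanish at the point `p j`, for `j = 1, …, r`. -/
noncomputable def linSysPts (K : Type*) [Field K] (D : Finset (ℕ × ℕ)) {r : ℕ}
    (m : Fin r → ℕ) (p : Fin r → K × K) : Submodule K (MvPolynomial (Fin 2) K) :=
  monoSpan K D ⊓ ⨅ j : Fin r, ⨅ β : ℕ × ℕ, ⨅ _ : β.1 + β.2 < m j,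
    LinearMap.ker (evalPt K (p j) ∘ₗ derivOp K β)

/-- `dim L_D(m₁,…,m_r)`: the minimum over all tuples of points of `dim_K L − 1`. -/
noncomputable def dimSys (K : Type*) [Field K] (D : Finset (ℕ × ℕ)) {r : ℕ}
    (m : Fin r → ℕ) : ℤ :=
  sInf (Set.range fun p : Fin r → K × K =>
    (Module.finrank K ↥(linSysPts K D m p) : ℤ) - 1)

/-- The virtual dimension `vdim = #D − 1 − Σ_j C(m_j + 1, 2)`. -/
def vdimSys (D : Finset (ℕ × ℕ)) {r : ℕ} (m : Fin r → ℕ) : ℤ :=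
  (D.card : ℤ) - 1 - ∑ j : Fin r, (((m j + 1).choose 2 : ℕ) : ℤ)

/-- A system is non-special if its dimension equals the expected dimension
`edim = max (vdim, −1)`. -/
def nonSpecial (K : Type*) [Field K] (D : Finset (ℕ × ℕ)) {r : ℕ}
    (m : Fin r → ℕ) : Prop :=
  dimSys K D m = max (vdimSys D m) (-1)

/-- The full diagram of degree `d`: `{α ∈ ℕ² : α₁ + α₂ ≤ d}`, so that
`L_{fullDiagram d} = L_d` is the system of curves of degree at most `d`. -/
def fullDiagram (d : ℕ) : Finset (ℕ × ℕ) :=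
  (Finset.range (d + 1) ×ˢ Finset.range (d + 1)).filter (fun x => x.1 + x.2 ≤ d)

/-- The multiplicity vector `(7^{×6}, 6^{×4}, 1)`. -/
def mult15 : Fin 11 → ℕ := fun j => if (j : ℕ) < 6 then 7 else if (j : ℕ) < 10 then 6 else 1


def fB : ℕ := 16777216
def fp : ℕ := 101

def force {α : Type} (x : ℕ) (f : ℕ → α) : α := Nat.casesOn x (f 0) (fun m => f (Nat.succ m))

theorem force_eq {α : Type} (x : ℕ) (f : ℕ → α) : force x f = f x := by cases x <;> rfl

/-- reduce the lowest `n` base-`B` digits modulo `p` -/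
def redRow : ℕ → ℕ → ℕ
  | 0, _ => 0
  | n + 1, R => force (Nat.div R fB) fun Q =>
      Nat.add (Nat.mod (Nat.mod R fB) fp) (Nat.mul fB (redRow n Q))

def stepRows (T s : ℕ) : List ℕ → (List ℕ → Bool) → Bool
  | [], k => k []
  | R :: Rs, k =>
    force (Nat.add (Nat.div R fB) (Nat.mul (Nat.mod (Nat.mul (Nat.mod R fB) s) fp) T)) fun v =>
      stepRows T s Rs fun l => k (v :: l)

def elim : ℕ → ℕ → List ℕ → Bool
  | 0, _, _ => false
  | f + 1, n, rows =>
    Nat.casesOn n true fun n' =>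
    List.casesOn rows false fun P Rs =>
      force (Nat.mod (Nat.mod P fB) fp) fun a =>
      force (Nat.mod (Nat.mul 100 (Nat.pow a 99)) fp) fun s =>
      Bool.casesOn (Nat.beq (Nat.mod (Nat.succ (Nat.mul s a)) fp) 0)
        (elim f n (Rs ++ [P]))
        (force (redRow n' (Nat.div P fB)) fun T => stepRows T s Rs fun l => elim f n' l)

def df (a : ℕ) : ℕ → ℕ
  | 0 => 1
  | k + 1 => Nat.mul (Nat.sub a k) (df a k)

def entry (q : (ℕ × ℕ) × (ℕ × ℕ)) (d : ℕ × ℕ) : ℕ :=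
  Nat.mul (Nat.mul (df d.1 q.2.1) (Nat.pow q.1.1 (Nat.sub d.1 q.2.1)))
    (Nat.mul (df d.2 q.2.2) (Nat.pow q.1.2 (Nat.sub d.2 q.2.2)))

def packRow (q : (ℕ × ℕ) × (ℕ × ℕ)) : List (ℕ × ℕ) → ℕ
  | [] => 0
  | d :: l => Nat.add (Nat.mod (entry q d) fp) (Nat.mul fB (packRow q l))

def cols : List (ℕ × ℕ) :=
  (List.range 22).flatMap fun a => (List.range (a + 1)).map fun b => (21 - a, a - b)

def pts : List (ℕ × (ℕ × ℕ)) :=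
  [(7, (5, 5)), (7, (9, 6)), (7, (5, 9)), (7, (1, 8)), (7, (6, 6)), (7, (3, 1)), (6, (1, 5)), (6, (9, 8)), (6, (2, 9)), (6, (4, 1)), (1, (7, 7))]

def conds : List ((ℕ × ℕ) × (ℕ × ℕ)) :=
  pts.flatMap fun q => (List.range q.1).flatMap fun i => (List.range (q.1 - i)).map fun j => (q.2, (i, j))

def forceAll (cs : List (ℕ × ℕ)) : List ((ℕ × ℕ) × (ℕ × ℕ)) → (List ℕ → Bool) → Bool
  | [], k => k []
  | q :: qs, k => force (packRow q cs) fun v => forceAll cs qs fun l => k (v :: l)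

def ev : ℕ → ℕ → (ℕ → ZMod 101) → ZMod 101
  | 0, _, _ => 0
  | n + 1, R, c => ((R % fB : ℕ) : ZMod 101) * c 0 + ev n (R / fB) (fun k => c (k + 1))

def bdd : ℕ → ℕ → ℕ → Prop
  | 0, _, _ => True
  | n + 1, b, R => R % fB ≤ b ∧ bdd n b (R / fB)

theorem fB_pos : 0 < fB := by decide

theorem bdd_mono {n b b' R : ℕ} (h : b ≤ b') (hR : bdd n b R) : bdd n b' R := by
  induction n generalizing R with
  | zero => trivial
  | succ n ih => exact ⟨hR.1.trans h, ih hR.2⟩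

theorem digit_split {X Y : ℕ} (h : X % fB + Y < fB) :
    (X + Y) % fB = X % fB + Y ∧ (X + Y) / fB = X / fB := by
  have h1 := Nat.div_add_mod X fB
  have h2 : X + Y = (X % fB + Y) + fB * (X / fB) := by omega
  rw [h2]
  refine ⟨?_, ?_⟩
  · rw [Nat.add_mul_mod_self_left, Nat.mod_eq_of_lt h]
  · rw [Nat.add_mul_div_left _ _ fB_pos, Nat.div_eq_of_lt h, zero_add]

theorem digit_comb {X T q : ℕ} (h : X % fB + q * (T % fB) < fB) :
    (X + q * T) % fB = X % fB + q * (T % fB) ∧ (X + q * T) / fB = X / fB + q * (T / fB) := by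
  have h1 := Nat.div_add_mod X fB
  have h2 := Nat.div_add_mod T fB
  have h3 : X + q * T = (X % fB + q * (T % fB)) + fB * (X / fB + q * (T / fB)) := by
    conv_lhs => rw [← h1, ← h2]
    ring
  rw [h3]
  refine ⟨?_, ?_⟩
  · rw [Nat.add_mul_mod_self_left, Nat.mod_eq_of_lt h]
  · rw [Nat.add_mul_div_left _ _ fB_pos, Nat.div_eq_of_lt h, zero_add]

theorem ev_comb {n : ℕ} : ∀ {b b' q X T : ℕ} (c : ℕ → ZMod 101), bdd n b X → bdd n b' T →
    b + q * b' < fB →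
    ev n (X + q * T) c = ev n X c + (q : ZMod 101) * ev n T c ∧ bdd n (b + q * b') (X + q * T) := by
  induction n with
  | zero => intro b b' q X T c _ _ _; simp [ev, bdd]
  | succ n ih =>
    intro b b' q X T c hX hT hb
    have hle : X % fB + q * (T % fB) ≤ b + q * b' :=
      Nat.add_le_add hX.1 (Nat.mul_le_mul_left _ hT.1)
    obtain ⟨h1, h2⟩ := digit_comb (lt_of_le_of_lt hle hb)
    obtain ⟨h3, h4⟩ := ih (fun k => c (k + 1)) hX.2 hT.2 hb
    refine ⟨?_, ?_⟩
    · simp only [ev, h1, h2, h3]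
      push_cast
      ring
    · exact ⟨by rw [h1]; exact hle, by rw [h2]; exact h4⟩

theorem digit_cons {a Q : ℕ} (h : a < fB) : (a + fB * Q) % fB = a ∧ (a + fB * Q) / fB = Q := by
  refine ⟨?_, ?_⟩
  · rw [Nat.add_mul_mod_self_left, Nat.mod_eq_of_lt h]
  · rw [Nat.add_mul_div_left _ _ fB_pos, Nat.div_eq_of_lt h, zero_add]

theorem mod_fp_lt (a : ℕ) : a % fp < fB := lt_trans (Nat.mod_lt _ (by decide)) (by decide : fp < fB)

theorem mod_fp_le (a : ℕ) : a % fp ≤ 100 := Nat.le_of_lt_succ (Nat.mod_lt _ (by decide))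

theorem cast_mod_fp (a : ℕ) : ((a % fp : ℕ) : ZMod 101) = (a : ZMod 101) := by
  simp [fp]

theorem redRow_succ (n R : ℕ) : redRow (n + 1) R = R % fB % fp + fB * redRow n (R / fB) := by
  simp only [redRow, force_eq]; rfl

theorem redRow_spec {n : ℕ} : ∀ {R : ℕ} (c : ℕ → ZMod 101),
    ev n (redRow n R) c = ev n R c ∧ bdd n 100 (redRow n R) := by
  induction n with
  | zero => intro R c; simp [ev, bdd]
  | succ n ih =>
    intro R c
    obtain ⟨h1, h2⟩ := digit_cons (Q := redRow n (R / fB)) (mod_fp_lt (R % fB))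
    obtain ⟨h3, h4⟩ := ih (R := R / fB) (fun k => c (k + 1))
    rw [redRow_succ]
    refine ⟨?_, ?_⟩
    · simp only [ev, h1, h2, h3, cast_mod_fp]
    · exact ⟨by rw [h1]; exact mod_fp_le _, by rw [h2]; exact h4⟩

theorem stepRows_eq (T s : ℕ) (Rs : List ℕ) (k : List ℕ → Bool) :
    stepRows T s Rs k = k (Rs.map fun R => R / fB + ((R % fB) * s % fp) * T) := by
  induction Rs generalizing k with
  | nil => rfl
  | cons R Rs ih => simp only [stepRows, force_eq, ih]; rfl

theorem elim_sound (f : ℕ) : ∀ (n : ℕ) (rows : List ℕ) (b : ℕ) (c : ℕ → ZMod 101),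
    elim f n rows = true → b + n * 10000 < fB → (∀ R ∈ rows, bdd n b R) →
    (∀ R ∈ rows, ev n R c = 0) → ∀ i < n, c i = 0 := by
  induction f with
  | zero => intro n rows b c h; simp [elim] at h
  | succ f ih =>
    intro n rows b c h hb hbd hev
    cases n with
    | zero => intro i hi; omega
    | succ n =>
    cases rows with
    | nil => simp [elim] at h
    | cons P Rs =>
    simp only [elim, force_eq, stepRows_eq] at h
    set a := Nat.mod (Nat.mod P fB) fp with ha
    set s := Nat.mod (Nat.mul 100 (Nat.pow a 99)) fp with hs
    cases hc : Nat.beq (Nat.mod (Nat.succ (Nat.mul s a)) fp) 0 with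
    | false =>
      rw [hc] at h
      refine ih (n + 1) (Rs ++ [P]) b c h hb ?_ ?_
      · intro R hR; exact hbd R (by simp at hR ⊢; tauto)
      · intro R hR; exact hev R (by simp at hR ⊢; tauto)
    | true =>
      rw [hc] at h
      have h' : elim f n (Rs.map fun R => R / fB + ((R % fB) * s % fp) *
        redRow n (P / fB)) = true := h
      clear h
      have hsa : (s : ZMod 101) * ((P % fB : ℕ) : ZMod 101) = -1 := by
        have h1 : (s * a + 1) % fp = 0 := Nat.eq_of_beq_eq_true hc
        have h2 : ((s * a + 1 : ℕ) : ZMod 101) = 0 := by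
          rw [← cast_mod_fp, h1]; rfl
        have h3 : (a : ZMod 101) = ((P % fB : ℕ) : ZMod 101) := cast_mod_fp _
        push_cast at h2
        rw [← h3]
        exact eq_neg_of_add_eq_zero_left h2
      have hP := hev P (by simp)
      simp only [ev] at hP
      obtain ⟨hT1, hT2⟩ := redRow_spec (n := n) (R := P / fB) (fun k => c (k + 1))
      have key : ∀ i < n, (fun k => c (k + 1)) i = 0 := by
        have hq : ∀ R, (R % fB) * s % fp ≤ 100 := fun R => mod_fp_le _
        have hlt : ∀ R, b + ((R % fB) * s % fp) * 100 ≤ b + 10000 := fun R => by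
          have := hq R; omega
        refine ih n _ (b + 10000) _ h' (by omega) ?_ ?_
        · intro R' hR'
          obtain ⟨R, hR, rfl⟩ := List.mem_map.1 hR'
          have hbR := hbd R (by simp [hR])
          exact bdd_mono (hlt R) (ev_comb (fun k => c (k + 1)) hbR.2 hT2
            (lt_of_le_of_lt (hlt R) (by omega))).2
        · intro R' hR'
          obtain ⟨R, hR, rfl⟩ := List.mem_map.1 hR'
          have hbR := hbd R (by simp [hR])
          rw [(ev_comb (fun k => c (k + 1)) hbR.2 hT2
            (lt_of_le_of_lt (hlt R) (by omega))).1, hT1]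
          have hRe := hev R (by simp [hR])
          simp only [ev] at hRe
          rw [cast_mod_fp, Nat.cast_mul]
          linear_combination hRe + ((R % fB : ℕ) : ZMod 101) * s * hP
            - ((R % fB : ℕ) : ZMod 101) * c 0 * hsa
      have hz : ∀ (m : ℕ) (X : ℕ) (e : ℕ → ZMod 101), (∀ i < m, e i = 0) → ev m X e = 0 := by
        intro m
        induction m with
        | zero => intro X e _; rfl
        | succ m ihm =>
          intro X e he
          simp only [ev]
          rw [he 0 (by omega), ihm _ _ (fun i hi => he (i + 1) (by omega))]
          simp
      have h0 : c 0 = 0 := by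
        rw [hz n _ _ key] at hP
        linear_combination (c 0) * hsa - (s : ZMod 101) * hP
      intro i hi
      cases i with
      | zero => exact h0
      | succ i => exact key i (by omega)

theorem packRow_cons (q : (ℕ × ℕ) × (ℕ × ℕ)) (d : ℕ × ℕ) (l : List (ℕ × ℕ)) :
    packRow q (d :: l) = entry q d % fp + fB * packRow q l := rfl

theorem packRow_spec (q : (ℕ × ℕ) × (ℕ × ℕ)) : ∀ (l : List (ℕ × ℕ)) (c : ℕ → ZMod 101),
    ev l.length (packRow q l) c = ∑ k : Fin l.length, (entry q (l.get k) : ZMod 101) * c k ∧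
    bdd l.length 100 (packRow q l) := by
  intro l
  induction l with
  | nil => intro c; simp [ev, bdd]
  | cons d l ih =>
    intro c
    obtain ⟨h1, h2⟩ := digit_cons (Q := packRow q l) (mod_fp_lt (entry q d))
    obtain ⟨h3, h4⟩ := ih (fun k => c (k + 1))
    rw [packRow_cons]
    refine ⟨?_, ?_⟩
    · simp only [List.length_cons, ev, h1, h2, h3, cast_mod_fp]
      rw [Fin.sum_univ_succ]
      simp
    · exact ⟨by rw [h1]; exact mod_fp_le _, by rw [h2]; exact h4⟩

theorem forceAll_eq (cs : List (ℕ × ℕ)) (qs : List ((ℕ × ℕ) × (ℕ × ℕ))) (k : List ℕ → Bool) :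
    forceAll cs qs k = k (qs.map fun q => packRow q cs) := by
  induction qs generalizing k with
  | nil => rfl
  | cons q qs ih => simp only [forceAll, force_eq, ih]; rfl

theorem cols_length : cols.length = 253 := by decide +kernel
theorem conds_length : conds.length = cols.length := by decide +kernel

theorem computation : forceAll cols conds (fun l => elim 400 253 l) = true := by decide +kernel

theorem modp_gen (cs : List (ℕ × ℕ)) (qs : List ((ℕ × ℕ) × (ℕ × ℕ))) (f n : ℕ) (hn : cs.length = n)
    (hnb : 100 + n * 10000 < fB)
    (hc : forceAll cs qs (fun l => elim f n l) = true) (c : ℕ → ZMod 101)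
    (h : ∀ q ∈ qs, ∑ k : Fin cs.length, (entry q (cs.get k) : ZMod 101) * c k = 0) :
    ∀ i < cs.length, c i = 0 := by
  subst hn
  rw [forceAll_eq] at hc
  refine elim_sound f _ _ 100 c hc hnb ?_ ?_
  · intro R hR
    obtain ⟨q, hq, rfl⟩ := List.mem_map.1 hR
    exact (packRow_spec q cs c).2
  · intro R hR
    obtain ⟨q, hq, rfl⟩ := List.mem_map.1 hR
    rw [(packRow_spec q cs c).1]
    exact h q hq

theorem modp_trivial (c : ℕ → ZMod 101)
    (h : ∀ q ∈ conds, ∑ k : Fin cols.length, (entry q (cols.get k) : ZMod 101) * c k = 0) :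
    ∀ i < cols.length, c i = 0 :=
  modp_gen cols conds 400 253 cols_length (by decide) computation c h

instance : Fact (Nat.Prime 101) := ⟨by norm_num⟩

def bigM : Matrix (Fin cols.length) (Fin cols.length) ℤ :=
  fun r k => (entry (conds.get (r.cast conds_length.symm)) (cols.get k) : ℤ)

theorem bigM_det : bigM.det ≠ 0 := by
  intro h
  have h1 : (bigM.map (Int.castRingHom (ZMod 101))).det = 0 := by
    have := (Int.castRingHom (ZMod 101)).map_det bigM
    rw [h, map_zero] at this
    exact this.symm
  obtain ⟨w, hw, hMw⟩ := Matrix.exists_mulVec_eq_zero_iff.2 h1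
  apply hw
  have := modp_trivial (fun k => if hk : k < cols.length then w ⟨k, hk⟩ else 0) ?_
  · funext k
    have := this k k.2
    simpa using this
  · intro q hq
    obtain ⟨r, rfl⟩ := List.get_of_mem hq
    have := congrFun hMw (r.cast conds_length)
    simpa [Matrix.mulVec, dotProduct, bigM] using this

theorem char0_trivial {K : Type*} [Field K] [CharZero K] (v : Fin cols.length → K)
    (h : ∀ q ∈ conds, ∑ k : Fin cols.length, (entry q (cols.get k) : K) * v k = 0) : v = 0 := by
  by_contra hv
  apply bigM_det
  have h1 : (bigM.map (Int.castRingHom K)).det = 0 := by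
    refine Matrix.exists_mulVec_eq_zero_iff.1 ⟨v, hv, ?_⟩
    funext r
    have := h _ (List.get_mem conds (r.cast conds_length.symm))
    simpa [Matrix.mulVec, dotProduct, bigM] using this
  have := (Int.castRingHom K).map_det bigM
  rw [show (Int.castRingHom K).mapMatrix bigM = bigM.map (Int.castRingHom K) from rfl, h1] at this
  exact Int.cast_eq_zero.1 this

theorem pderiv_pow_monomial {K : Type*} [CommRing K] (i : Fin 2) (n : ℕ) (s : Fin 2 →₀ ℕ) (a : K) :
    ((pderiv i).toLinearMap ^ n : Module.End K (MvPolynomial (Fin 2) K)) (monomial s a) =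
      monomial (s - Finsupp.single i n) (a * (df (s i) n : K)) := by
  induction n with
  | zero => simp [df]
  | succ n ih =>
    rw [pow_succ', Module.End.mul_apply, ih]
    have h1 : df (s i) (n + 1) = (s i - n) * df (s i) n := rfl
    rw [h1]
    simp only [Derivation.coeFn_coe, pderiv_monomial]
    rw [tsub_tsub, ← Finsupp.single_add]
    congr 1
    simp
    ring

theorem eval_deriv_monomial {K : Type*} [CommRing K] (x y : ℕ) (β d : ℕ × ℕ) :
    evalPt K ((x : K), (y : K)) (derivOp K β
      (monomial (Finsupp.single (0 : Fin 2) d.1 + Finsupp.single 1 d.2) (1 : K))) =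
      (entry ((x, y), β) d : K) := by
  have he : entry ((x, y), β) d =
    (df d.1 β.1 * x ^ (d.1 - β.1)) * (df d.2 β.2 * y ^ (d.2 - β.2)) := rfl
  rw [he, derivOp, Module.End.mul_apply, pderiv_pow_monomial, pderiv_pow_monomial, evalPt]
  simp only [AlgHom.toLinearMap_apply, aeval_monomial]
  rw [Finsupp.prod_fintype _ _ (by simp)]
  simp [Fin.prod_univ_two]
  ring

theorem mem_cols (d : ℕ × ℕ) : d ∈ cols ↔ d.1 + d.2 ≤ 21 := by
  obtain ⟨a, b⟩ := d
  simp only [cols, List.mem_flatMap, List.mem_map, List.mem_range, Prod.mk.injEq]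
  constructor
  · rintro ⟨u, hu, v, hv, h1, h2⟩; omega
  · intro h; exact ⟨21 - a, by omega, 21 - a - b, by omega, by omega, by omega⟩

theorem cols_nodup : cols.Nodup := by decide +kernel

noncomputable def mon (d : ℕ × ℕ) : Fin 2 →₀ ℕ := Finsupp.single (0 : Fin 2) d.1 + Finsupp.single 1 d.2

theorem mon_inj {d e : ℕ × ℕ} (h : mon d = mon e) : d = e := by
  have h0 := DFunLike.congr_fun h 0
  have h1 := DFunLike.congr_fun h 1
  simp [mon] at h0 h1
  exact Prod.ext h0 h1

theorem mon_surj (s : Fin 2 →₀ ℕ) : mon (s 0, s 1) = s := by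
  ext i; fin_cases i <;> simp [mon]

theorem sum_get_gen {M α : Type*} [AddCommMonoid M] (l : List α) (g : α → M) :
    ∑ k : Fin l.length, g (l.get k) = (l.map g).sum := by
  induction l with
  | nil => simp
  | cons d l ih => simp only [List.length_cons, Fin.sum_univ_succ, List.map_cons, List.sum_cons, ← ih]; rfl

theorem poly_eq {K : Type*} [Field K] (f : MvPolynomial (Fin 2) K) (hf : f.totalDegree ≤ 21) :
    f = ∑ k : Fin cols.length, (coeff (mon (cols.get k)) f) • monomial (mon (cols.get k)) (1 : K) := by
  have h1 : ∑ k : Fin cols.length, (coeff (mon (cols.get k)) f) • monomial (mon (cols.get k)) (1 : K)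
      = ∑ d ∈ cols.toFinset, (coeff (mon d) f) • monomial (mon d) (1 : K) := by
    rw [List.sum_toFinset _ cols_nodup]
    exact sum_get_gen cols fun d => (coeff (mon d) f) • monomial (mon d) (1 : K)
  rw [h1]
  ext s
  simp only [coeff_sum, coeff_smul, coeff_monomial, smul_eq_mul, mul_ite, mul_one, mul_zero]
  by_cases hs : s 0 + s 1 ≤ 21
  · rw [Finset.sum_eq_single (s 0, s 1)]
    · simp [mon_surj]
    · intro d _ hd
      rw [if_neg]
      intro h
      exact hd (mon_inj (h.trans (mon_surj s).symm))
    · intro h; exact absurd (List.mem_toFinset.2 ((mem_cols _).2 hs)) h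
  · have h0 : coeff s f = 0 := by
      apply coeff_eq_zero_of_totalDegree_lt
      have : ∑ i ∈ s.support, s i = s 0 + s 1 := by
        rw [← Fin.sum_univ_two (fun i => s i)]
        exact Finset.sum_subset (Finset.subset_univ _) (by simp)
      rw [this]; omega
    rw [h0, Finset.sum_eq_zero]
    intro d _
    split_ifs with h
    · rw [h, h0]
    · rfl

def ptFun (j : Fin 11) : ℕ × ℕ := (pts.get (j.cast (by decide))).2

theorem pts_mult : ∀ e ∈ pts, ∃ j : Fin 11, mult15 j = e.1 ∧ ptFun j = e.2 := by decide +kernel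

theorem main_trivial {K : Type*} [Field K] [CharZero K] (f : MvPolynomial (Fin 2) K)
    (hf : f.totalDegree ≤ 21)
    (h : ∀ j : Fin 11, ∀ β : ℕ × ℕ, β.1 + β.2 < mult15 j →
        evalPt K (((ptFun j).1 : K), ((ptFun j).2 : K)) (derivOp K β f) = 0) : f = 0 := by
  have hv := char0_trivial (fun k => coeff (mon (cols.get k)) f) ?_
  · rw [poly_eq f hf]
    apply Finset.sum_eq_zero
    intro k _
    have := congrFun hv k
    simp only [Pi.zero_apply] at this
    rw [this, zero_smul]
  · intro q hq
    simp only [conds, List.mem_flatMap, List.mem_map, List.mem_range] at hq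
    obtain ⟨e, he, i, hi, i', hi', rfl⟩ := hq
    obtain ⟨j, hj1, hj2⟩ := pts_mult e he
    have := h j (i, i') (by simp only [hj1]; omega)
    rw [poly_eq f hf, hj2, map_sum, map_sum] at this
    rw [← this]
    apply Finset.sum_congr rfl
    intro k _
    rw [map_smul, map_smul, mon, eval_deriv_monomial, smul_eq_mul, mul_comm]

theorem linSys_bot {K : Type*} [Field K] [CharZero K] :
    linSysPts K (fullDiagram 21) mult15
      (fun j => (((ptFun j).1 : K), ((ptFun j).2 : K))) = ⊥ := by
  rw [eq_bot_iff]
  intro f hf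
  rw [linSysPts, Submodule.mem_inf] at hf
  obtain ⟨h1, h2⟩ := hf
  simp only [Submodule.mem_iInf, LinearMap.mem_ker, LinearMap.comp_apply] at h2
  refine (Submodule.mem_bot K).2 (main_trivial f ?_ h2)
  rw [← mem_restrictTotalDegree]
  refine (Submodule.span_le (p := restrictTotalDegree (Fin 2) K 21)).2 ?_ h1
  rintro _ ⟨d, hd, rfl⟩
  simp only [SetLike.mem_coe, mem_restrictTotalDegree]
  refine (totalDegree_monomial_le _ _).trans ?_
  have hd' : d.1 + d.2 ≤ 21 := (Finset.mem_filter.1 hd).2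
  rw [Finsupp.sum_fintype _ _ (by simp)]
  simpa [Fin.sum_univ_two] using hd'

theorem dim_eq {K : Type*} [Field K] [CharZero K] :
    dimSys K (fullDiagram 21) mult15 = -1 := by
  rw [dimSys]
  apply le_antisymm
  · refine csInf_le ⟨-1, ?_⟩ ⟨fun j => (((ptFun j).1 : K), ((ptFun j).2 : K)), ?_⟩
    · rintro _ ⟨p, rfl⟩
      simp only
      omega
    · have h0 : Module.finrank K ↥(linSysPts K (fullDiagram 21) mult15
          (fun j => (((ptFun j).1 : K), ((ptFun j).2 : K)))) = 0 := by
        rw [linSys_bot]; exact finrank_bot K _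
      simp only [h0]
      rfl
  · refine le_csInf (Set.range_nonempty _) ?_
    rintro _ ⟨p, rfl⟩
    simp only
    omega

theorem vdim_eq : vdimSys (fullDiagram 21) mult15 = -1 := by decide +kernel

/-- The system `L_21(7^{×6}, 6^{×4}, 1)` is non-special; since its
virtual dimension equals `−1`, this means `dim L_21(7^{×6}, 6^{×4}, 1) = −1`, i.e. there
exist points `p₁,…,p₁₁ ∈ K²` such that the only polynomial `f ∈ K[X,Y]` of total degree
`≤ 21` with multiplicity `≥ 7` at `p₁,…,p₆`, multiplicity `≥ 6` at `p₇,…,p₁₀`, and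
vanishing at `p₁₁`, is `f = 0`. -/
theorem statement15 {K : Type*} [Field K] [CharZero K] :
    nonSpecial K (fullDiagram 21) mult15 ∧
    dimSys K (fullDiagram 21) mult15 = -1 ∧
    ∃ p : Fin 11 → K × K, ∀ f : MvPolynomial (Fin 2) K,
      f.totalDegree ≤ 21 →
      (∀ j : Fin 11, ∀ β : ℕ × ℕ, β.1 + β.2 < mult15 j →
        evalPt K (p j) (derivOp K β f) = 0) →
      f = 0 := by
  refine ⟨?_, dim_eq, fun j => (((ptFun j).1 : K), ((ptFun j).2 : K)), main_trivial⟩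
  rw [nonSpecial, dim_eq, vdim_eq]
  rfl
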